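/- For fixed c > 0 with μ⁺ < ∞, the map δ ↦ p_δ(c) is continuous on ℝ. -/

import Mathlib

open MeasureTheory Set

/-- Asymptotic δ-record probability in the linear drift model with trend `c`. -/
noncomputable def pdelta (F f : ℝ → ℝ) (c δ : ℝ) : ℝ :=
  ∫ x : ℝ, (∏' i : ℕ, F (x + c * (i + 1) - δ)) * f x

lemma multipliable_of_mem_Icc {ι : Type*} {a : ι → ℝ} (ha : ∀ i, a i ∈ Icc (0 : ℝ) 1) :
    Multipliable a := by
  have hanti : Antitone fun s : Finset ι => ∏ i ∈ s, a i :=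
    Finset.prod_anti_set_of_le_one (fun i => (ha i).1) fun i => (ha i).2
  have hbdd : BddBelow (range fun s : Finset ι => ∏ i ∈ s, a i) :=
    ⟨0, by rintro _ ⟨s, rfl⟩; exact Finset.prod_nonneg fun i _ => (ha i).1⟩
  refine ⟨⨅ s : Finset ι, ∏ i ∈ s, a i, ?_⟩
  simpa [HasProd] using tendsto_atTop_ciInf hanti hbdd

lemma tprod_mem_Icc {ι : Type*} {a : ι → ℝ} (ha : ∀ i, a i ∈ Icc (0 : ℝ) 1) :
    ∏' i, a i ∈ Icc (0 : ℝ) 1 :=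
  isClosed_Icc.mem_of_tendsto (multipliable_of_mem_Icc ha).hasProd <| .of_forall fun _ =>
    ⟨Finset.prod_nonneg fun i _ => (ha i).1,
      Finset.prod_le_one (fun i _ => (ha i).1) fun i _ => (ha i).2⟩

lemma tprod_le_tprod_of_mem_Icc {ι : Type*} {a b : ι → ℝ} (ha : ∀ i, a i ∈ Icc (0 : ℝ) 1)
    (hb : ∀ i, b i ∈ Icc (0 : ℝ) 1) (hab : ∀ i, a i ≤ b i) : ∏' i, a i ≤ ∏' i, b i :=
  le_of_tendsto_of_tendsto' (multipliable_of_mem_Icc ha).hasProd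
    (multipliable_of_mem_Icc hb).hasProd fun _ =>
      Finset.prod_le_prod (fun i _ => (ha i).1) fun i _ => hab i

/-- Convolving a bounded monotone function with an integrable one gives a continuous function:
the translates converge almost everywhere, as a monotone function has countably many jumps. -/
lemma continuous_integral_monotone_sub_mul {G f : ℝ → ℝ} (hG : Monotone G)
    (hG01 : ∀ x, G x ∈ Icc (0 : ℝ) 1) (hf : Integrable f) :
    Continuous fun δ : ℝ => ∫ x : ℝ, G (x - δ) * f x := by
  rw [continuous_iff_continuousAt]
  intro δ₀
  refine continuousAt_of_dominated (bound := fun x => ‖f x‖) ?_ ?_ hf.norm ?_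
  · exact .of_forall fun δ => (hG.measurable.comp
      (measurable_id.sub_const δ)).aestronglyMeasurable.mul hf.aestronglyMeasurable
  · refine .of_forall fun δ => .of_forall fun x => ?_
    rw [norm_mul, Real.norm_of_nonneg (hG01 _).1]
    exact mul_le_of_le_one_left (norm_nonneg _) (hG01 _).2
  · have hcount : {x : ℝ | ¬ ContinuousAt G (x - δ₀)}.Countable :=
      hG.countable_not_continuousAt.preimage (sub_left_injective (b := δ₀))
    have hae : ∀ᵐ x : ℝ, ContinuousAt G (x - δ₀) := hcount.measure_zero volume
    filter_upwards [hae] with x hx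
    exact (ContinuousAt.comp (f := fun δ : ℝ => x - δ) hx (by fun_prop)).mul
      continuousAt_const

/-- For fixed `c > 0` with `μ⁺ < ∞`, the map `δ ↦ p_δ(c)` is continuous on `ℝ`. -/
theorem stmt5 (F f : ℝ → ℝ) (xm xp : EReal) (hx : xm < xp)
    (hf : ∀ x, 0 ≤ f x) (hfm : Measurable f)
    (hsupp : ∀ x : ℝ, 0 < f x ↔ (xm < (x : EReal) ∧ (x : EReal) < xp))
    (hcdf : ∀ x, F x = ∫ t in Iic x, f t)
    (hprob : ∫ x : ℝ, f x = 1)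
    (hmu : IntegrableOn (fun x => x * f x) (Ioi (0 : ℝ)))
    (c : ℝ) (hc : 0 < c) :
    Continuous (fun δ : ℝ => pdelta F f c δ) := by
  have hint : Integrable f := by
    by_contra h
    simp [integral_undef h] at hprob
  have hF01 : ∀ x, F x ∈ Icc (0 : ℝ) 1 := fun x => by
    rw [hcdf]
    exact ⟨integral_nonneg hf, hprob ▸ setIntegral_le_integral hint (.of_forall hf)⟩
  have hFmono : Monotone F := fun x y hxy => by
    rw [hcdf, hcdf]
    exact setIntegral_mono_set hint.integrableOn (.of_forall hf)
      (Iic_subset_Iic.2 hxy).eventuallyLE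
  have hG : Monotone fun y => ∏' i : ℕ, F (y + c * (i + 1)) := fun x y hxy =>
    tprod_le_tprod_of_mem_Icc (fun _ => hF01 _) (fun _ => hF01 _) fun _ => hFmono (by gcongr)
  have hcont := continuous_integral_monotone_sub_mul hG
    (fun _ => tprod_mem_Icc fun _ => hF01 _) hint
  simpa only [pdelta, add_sub_right_comm] using hcont
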